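/- The Knothe–Rosenblatt distance d_p^KR is a metric on 𝒫^p(ℝ²): for all μ, ν, η ∈ 𝒫^p(ℝ²) it is finite, nonnegative and symmetric, d_p^KR(μ,ν) = 0 if and only if μ = ν, and d_p^KR(μ,ν) ≤ d_p^KR(μ,η) + d_p^KR(η,ν). -/

import Mathlib

open MeasureTheory ProbabilityTheory Filter
open scoped ENNReal NNReal Topology

noncomputable section

/-- `dund` is a metric on `ℝ` inducing the usual topology. -/
structure IsCompatibleMetric (dund : ℝ → ℝ → ℝ) : Prop where
  self_eq_zero : ∀ x, dund x x = 0
  eq_of_dist_eq_zero : ∀ x y, dund x y = 0 → x = y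
  symm : ∀ x y, dund x y = dund y x
  triangle : ∀ x y z, dund x z ≤ dund x y + dund y z
  compatible : ∀ (x : ℝ) (u : ℕ → ℝ),
    Tendsto u atTop (nhds x) ↔ Tendsto (fun n => dund (u n) x) atTop (nhds 0)

/-- Couplings: measures on the product with prescribed marginals. -/
def coupling {α β : Type*} [MeasurableSpace α] [MeasurableSpace β]
    (μ : Measure α) (ν : Measure β) : Set (Measure (α × β)) :=
  {γ | γ.map Prod.fst = μ ∧ γ.map Prod.snd = ν}

/-- A coupling `γ` on `ℝ² × ℝ²`, viewed as the joint law of two-stage processes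
`X = (X₁,X₂)` and `Y = (Y₁,Y₂)`, is bicausal if for every Borel `B ⊆ ℝ` one has
`ℙ(Y₁ ∈ B | X₁,X₂) = ℙ(Y₁ ∈ B | X₁)` a.s. and `ℙ(X₁ ∈ B | Y₁,Y₂) = ℙ(X₁ ∈ B | Y₁)` a.s. -/
def Bicausal2 (γ : Measure ((ℝ × ℝ) × (ℝ × ℝ))) : Prop :=
  ∀ B : Set ℝ, MeasurableSet B →
    (γ[fun z => Set.indicator B (fun _ => (1 : ℝ)) z.2.1 |
        MeasurableSpace.comap Prod.fst inferInstance]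
      =ᵐ[γ]
     γ[fun z => Set.indicator B (fun _ => (1 : ℝ)) z.2.1 |
        MeasurableSpace.comap (fun z : (ℝ × ℝ) × (ℝ × ℝ) => z.1.1) inferInstance]) ∧
    (γ[fun z => Set.indicator B (fun _ => (1 : ℝ)) z.1.1 |
        MeasurableSpace.comap Prod.snd inferInstance]
      =ᵐ[γ]
     γ[fun z => Set.indicator B (fun _ => (1 : ℝ)) z.1.1 |
        MeasurableSpace.comap (fun z : (ℝ × ℝ) × (ℝ × ℝ) => z.2.1) inferInstance])

/-- The `p`-th power cost `d(x,y)^p = d̲(x₁,y₁)^p + d̲(x₂,y₂)^p` on `ℝ² × ℝ²`. -/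
def cost2 (p : ℝ) (dund : ℝ → ℝ → ℝ) (z : (ℝ × ℝ) × (ℝ × ℝ)) : ℝ≥0∞ :=
  ENNReal.ofReal (dund z.1.1 z.2.1 ^ p + dund z.1.2 z.2.2 ^ p)

/-- The nested distance `d_p^nd(μ,ν) = (inf_{γ ∈ Π_bc(μ,ν)} ∫ d^p dγ)^{1/p}` on `𝒫^p(ℝ²)`. -/
def nestedDist2 (p : ℝ) (dund : ℝ → ℝ → ℝ) (μ ν : Measure (ℝ × ℝ)) : ℝ≥0∞ :=
  (⨅ γ : {γ : Measure ((ℝ × ℝ) × (ℝ × ℝ)) // γ ∈ coupling μ ν ∧ Bicausal2 γ},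
      ∫⁻ z, cost2 p dund z ∂(γ : Measure _)) ^ (1 / p)

/-- Membership in `𝒫^p(ℝ²)`: a probability measure with a finite `p`-th moment. -/
def MemP2 (p : ℝ) (dund : ℝ → ℝ → ℝ) (μ : Measure (ℝ × ℝ)) : Prop :=
  IsProbabilityMeasure μ ∧
    ∃ x₀ : ℝ × ℝ, ∫⁻ x, cost2 p dund (x, x₀) ∂μ < ⊤

/-- The `p`-Wasserstein distance on measures on the line, w.r.t. the base metric `d̲`. -/
def Wp (p : ℝ) (dund : ℝ → ℝ → ℝ) (m m' : Measure ℝ) : ℝ≥0∞ :=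
  (⨅ η : {η : Measure (ℝ × ℝ) // η ∈ coupling m m'},
      ∫⁻ q : ℝ × ℝ, ENNReal.ofReal (dund q.1 q.2 ^ p) ∂(η : Measure (ℝ × ℝ))) ^ (1 / p)

/-- The regular conditional distribution of the second coordinate given the first
(with a junk value for non-finite measures). -/
def condK (μ : Measure (ℝ × ℝ)) : Kernel ℝ ℝ :=
  haveI := Classical.dec (IsFiniteMeasure μ)
  if h : IsFiniteMeasure μ then @Measure.condKernel ℝ ℝ _ _ _ _ μ h else 0

/-- The cdf of a measure on the line. -/
def cdfE (η : Measure ℝ) (y : ℝ) : ℝ≥0∞ := η (Set.Iic y)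

/-- The left-continuous generalized inverse `F_η^{-1}(u) = inf { y : F_η(y) ≥ u }`. -/
def quantile (η : Measure ℝ) (u : ℝ) : ℝ :=
  sInf {y : ℝ | ENNReal.ofReal u ≤ cdfE η y}

/-- The (increasing) Knothe–Rosenblatt rearrangement of `μ` and `ν`: the joint law of
`((X₁,X₂),(Y₁,Y₂))` where `X₁ = F_{μ₁}^{-1}(U₁)`, `Y₁ = F_{ν₁}^{-1}(U₁)`,
`X₂ = F_{μ^{X₁}}^{-1}(U₂)`, `Y₂ = F_{ν^{Y₁}}^{-1}(U₂)` for independent uniforms `U₁, U₂`. -/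
def KR (μ ν : Measure (ℝ × ℝ)) : Measure ((ℝ × ℝ) × (ℝ × ℝ)) :=
  ((volume.restrict (Set.Ioo (0 : ℝ) 1)).prod (volume.restrict (Set.Ioo (0 : ℝ) 1))).map
    (fun u =>
      ((quantile (μ.map Prod.fst) u.1,
        quantile (condK μ (quantile (μ.map Prod.fst) u.1)) u.2),
       (quantile (ν.map Prod.fst) u.1,
        quantile (condK ν (quantile (ν.map Prod.fst) u.1)) u.2)))

/-- The Knothe–Rosenblatt distance `d_p^KR(μ,ν) = (∫ d^p dπ)^{1/p}`, `π` the KR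
rearrangement of `μ` and `ν`. -/
def dKR (p : ℝ) (dund : ℝ → ℝ → ℝ) (μ ν : Measure (ℝ × ℝ)) : ℝ≥0∞ :=
  (∫⁻ z, cost2 p dund z ∂(KR μ ν)) ^ (1 / p)

/-- The uniform distribution on the unit interval. -/
def unif : Measure ℝ := volume.restrict (Set.Ioo (0 : ℝ) 1)

instance : IsProbabilityMeasure unif :=
  ⟨by simp [unif]⟩

lemma ae_unif_mem : ∀ᵐ u ∂unif, u ∈ Set.Ioo (0 : ℝ) 1 :=
  ae_restrict_mem measurableSet_Ioo

/-- Galois connection between the generalized inverse and the cdf. -/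
lemma quantile_le_iff (η : Measure ℝ) [IsProbabilityMeasure η] {u : ℝ}
    (hu : u ∈ Set.Ioo (0 : ℝ) 1) (y : ℝ) :
    quantile η u ≤ y ↔ ENNReal.ofReal u ≤ η (Set.Iic y) := by
  set S : Set ℝ := {y : ℝ | ENNReal.ofReal u ≤ cdfE η y}
  have hmono : ∀ a b, a ≤ b → a ∈ S → b ∈ S := fun a b hab ha =>
    le_trans (α := ℝ≥0∞) ha (measure_mono (Set.Iic_subset_Iic.2 hab))
  have hne : S.Nonempty := by
    have h := tendsto_measure_Iic_atTop η
    rw [measure_univ] at h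
    have h1 : ENNReal.ofReal u < 1 := by
      rw [← ENNReal.ofReal_one]
      exact (ENNReal.ofReal_lt_ofReal_iff one_pos).2 hu.2
    obtain ⟨a, ha⟩ := (h.eventually (lt_mem_nhds h1)).exists
    exact ⟨a, ha.le⟩
  have hbdd : BddBelow S := by
    have h := ENNReal.tendsto_ofReal (tendsto_cdf_atBot η)
    have h0 : ENNReal.ofReal 0 < ENNReal.ofReal u := by simpa using hu.1
    obtain ⟨a, ha⟩ := (h.eventually (gt_mem_nhds h0)).exists
    rw [ofReal_cdf] at ha
    refine ⟨a, fun b hb => ?_⟩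
    by_contra! hba
    exact absurd (hmono b a hba.le hb) (not_le.2 ha)
  refine ⟨fun h => ?_, fun h => csInf_le hbdd h⟩
  have hgt : ∀ z, y < z → z ∈ S := fun z hz => by
    obtain ⟨a, ha, haz⟩ := exists_lt_of_csInf_lt hne (h.trans_lt hz)
    exact hmono a z haz.le ha
  have hI : Set.Iic y = ⋂ n : ℕ, Set.Iic (y + 1 / ((n : ℝ) + 1)) := by
    ext z
    simp only [Set.mem_Iic, Set.mem_iInter]
    refine ⟨fun hz n => hz.trans (by simp; positivity), fun hz => ?_⟩
    refine ge_of_tendsto' (x := atTop) (f := fun n : ℕ => y + 1 / ((n : ℝ) + 1)) ?_ hz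
    simpa using tendsto_one_div_add_atTop_nhds_zero_nat.const_add y
  have hanti : Antitone fun n : ℕ => Set.Iic (y + 1 / ((n : ℝ) + 1)) := fun m n hmn =>
    Set.Iic_subset_Iic.2 (by gcongr)
  rw [hI, hanti.measure_iInter (fun n => measurableSet_Iic.nullMeasurableSet)
    ⟨0, measure_ne_top _ _⟩]
  exact le_iInf fun n => hgt _ (by simp; positivity)

/-- The generalized inverse of a kernel, set to zero outside the unit interval. -/
def quantileK {α : Type*} [MeasurableSpace α] (K : Kernel α ℝ) (z : α × ℝ) : ℝ :=
  (Set.univ ×ˢ Set.Ioo (0 : ℝ) 1).indicator (fun z => quantile (K z.1) z.2) z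

lemma quantileK_of_mem {α : Type*} [MeasurableSpace α] (K : Kernel α ℝ) (x : α) {u : ℝ}
    (hu : u ∈ Set.Ioo (0 : ℝ) 1) : quantileK K (x, u) = quantile (K x) u :=
  Set.indicator_of_mem (by simpa using hu) _

lemma measurable_quantileK {α : Type*} [MeasurableSpace α] (K : Kernel α ℝ) [IsMarkovKernel K] :
    Measurable (quantileK K) := by
  have hm : MeasurableSet ((Set.univ : Set α) ×ˢ Set.Ioo (0 : ℝ) 1) :=
    MeasurableSet.univ.prod measurableSet_Ioo
  refine measurable_of_restrict_of_restrict_compl hm ?_ ?_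
  · refine measurable_of_Iic fun y => ?_
    have : (((Set.univ : Set α) ×ˢ Set.Ioo (0 : ℝ) 1).domRestrict (quantileK K)) ⁻¹' Set.Iic y =
        Subtype.val ⁻¹' {z : α × ℝ | ENNReal.ofReal z.2 ≤ K z.1 (Set.Iic y)} := by
      ext ⟨⟨x, u⟩, hu⟩
      have hu' : u ∈ Set.Ioo (0 : ℝ) 1 := hu.2
      simp [quantileK_of_mem K x hu', quantile_le_iff (K x) hu' y]
    rw [this]
    refine measurable_subtype_coe (measurableSet_le (by fun_prop) ?_)
    exact (K.measurable_coe measurableSet_Iic).comp measurable_fst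
  · have : (((Set.univ : Set α) ×ˢ Set.Ioo (0 : ℝ) 1)ᶜ.domRestrict (quantileK K)) = fun _ => 0 := by
      ext ⟨z, hz⟩
      exact Set.indicator_of_notMem hz fun z : α × ℝ => quantile (K z.1) z.2
    rw [this]
    exact measurable_const

lemma aemeasurable_quantile (η : Measure ℝ) [IsProbabilityMeasure η] :
    AEMeasurable (quantile η) unif := by
  refine ⟨fun u => quantileK (Kernel.const Unit η) ((), u),
    (measurable_quantileK _).comp (by fun_prop), ?_⟩
  filter_upwards [ae_unif_mem] with u hu
  rw [quantileK_of_mem _ _ hu, Kernel.const_apply]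

lemma unif_setOf_ofReal_le (c : ℝ≥0∞) (hc : c ≤ 1) :
    unif {u | ENNReal.ofReal u ≤ c} = c := by
  have hc' : c ≠ ⊤ := ne_top_of_le_ne_top ENNReal.one_ne_top hc
  have hc1 : c.toReal ≤ 1 := ENNReal.toReal_le_of_le_ofReal zero_le_one (by simpa using hc)
  have h : ({u | ENNReal.ofReal u ≤ c} : Set ℝ) = Set.Iic c.toReal := by
    ext u
    exact ENNReal.ofReal_le_iff_le_toReal hc'
  rw [h, unif, Measure.restrict_congr_set Ioo_ae_eq_Ioc, Measure.restrict_apply measurableSet_Iic]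
  have h2 : Set.Iic c.toReal ∩ Set.Ioc (0 : ℝ) 1 = Set.Ioc 0 c.toReal := by
    ext u
    simp only [Set.mem_inter_iff, Set.mem_Iic, Set.mem_Ioc]
    exact ⟨fun h => ⟨h.2.1, h.1⟩, fun h => ⟨h.2, h.1, h.2.trans hc1⟩⟩
  rw [h2, Real.volume_Ioc, sub_zero, ENNReal.ofReal_toReal hc']

/-- Inverse transform sampling. -/
lemma map_quantile_unif (η : Measure ℝ) [IsProbabilityMeasure η] :
    unif.map (quantile η) = η := by
  have := Measure.isProbabilityMeasure_map (aemeasurable_quantile η)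
  refine Measure.ext_of_Iic _ _ fun y => ?_
  rw [Measure.map_apply_of_aemeasurable (aemeasurable_quantile η) measurableSet_Iic]
  rw [← unif_setOf_ofReal_le (η (Set.Iic y)) prob_le_one]
  refine measure_congr (eventuallyEq_set.2 ?_)
  filter_upwards [ae_unif_mem] with u hu
  exact quantile_le_iff η hu y

lemma lintegral_quantile_unif (η : Measure ℝ) [IsProbabilityMeasure η] {f : ℝ → ℝ≥0∞}
    (hf : Measurable f) : ∫⁻ u, f (quantile η u) ∂unif = ∫⁻ y, f y ∂η := by
  conv_rhs => rw [← map_quantile_unif η]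
  rw [lintegral_map' hf.aemeasurable (aemeasurable_quantile η)]

/-- The map sending two uniform variables to a sample of `μ`. -/
def krMap (μ : Measure (ℝ × ℝ)) (u : ℝ × ℝ) : ℝ × ℝ :=
  (quantile (μ.map Prod.fst) u.1, quantile (condK μ (quantile (μ.map Prod.fst) u.1)) u.2)

lemma condK_eq (μ : Measure (ℝ × ℝ)) [IsFiniteMeasure μ] : condK μ = μ.condKernel :=
  dif_pos _

instance (μ : Measure (ℝ × ℝ)) [IsFiniteMeasure μ] : IsMarkovKernel (condK μ) := by
  rw [condK_eq]; infer_instance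

instance (μ : Measure (ℝ × ℝ)) [IsProbabilityMeasure μ] :
    IsProbabilityMeasure (μ.map Prod.fst) :=
  Measure.isProbabilityMeasure_map measurable_fst.aemeasurable

lemma aemeasurable_krMap (μ : Measure (ℝ × ℝ)) [IsProbabilityMeasure μ] :
    AEMeasurable (krMap μ) (unif.prod unif) := by
  let q : ℝ → ℝ := fun u => quantileK (Kernel.const Unit (μ.map Prod.fst)) ((), u)
  have hq : Measurable q := (measurable_quantileK _).comp (by fun_prop)
  refine ⟨fun u => (q u.1, quantileK (condK μ) (q u.1, u.2)), ?_, ?_⟩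
  · exact (hq.comp measurable_fst).prodMk
      ((measurable_quantileK _).comp ((hq.comp measurable_fst).prodMk measurable_snd))
  · filter_upwards [Measure.quasiMeasurePreserving_fst.ae ae_unif_mem,
      Measure.quasiMeasurePreserving_snd.ae ae_unif_mem] with u h1 h2
    simp only [krMap, q, quantileK_of_mem _ _ h1, quantileK_of_mem _ _ h2, Kernel.const_apply]

lemma map_krMap (μ : Measure (ℝ × ℝ)) [IsProbabilityMeasure μ] :
    (unif.prod unif).map (krMap μ) = μ := by
  refine Measure.ext_of_lintegral _ fun f hf => ?_
  rw [lintegral_map' hf.aemeasurable (aemeasurable_krMap μ),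
    lintegral_prod (fun u => f (krMap μ u)) (hf.comp_aemeasurable (aemeasurable_krMap μ))]
  have h1 : ∀ u, ∫⁻ v, f (krMap μ (u, v)) ∂unif =
      ∫⁻ y, f (quantile (μ.map Prod.fst) u, y) ∂condK μ (quantile (μ.map Prod.fst) u) := fun u =>
    lintegral_quantile_unif (condK μ (quantile (μ.map Prod.fst) u))
      (f := fun y => f (quantile (μ.map Prod.fst) u, y)) (by fun_prop)
  simp_rw [h1]
  rw [lintegral_quantile_unif (μ.map Prod.fst) (f := fun x => ∫⁻ y, f (x, y) ∂condK μ x)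
    hf.lintegral_kernel_prod_right', condK_eq]
  exact Measure.lintegral_condKernel hf

namespace IsCompatibleMetric

variable {dund : ℝ → ℝ → ℝ}

lemma nonneg (hd : IsCompatibleMetric dund) (x y : ℝ) : 0 ≤ dund x y := by
  have h := hd.triangle x y x
  rw [hd.self_eq_zero, hd.symm y x] at h
  linarith

lemma continuous (hd : IsCompatibleMetric dund) :
    Continuous fun z : ℝ × ℝ => dund z.1 z.2 := by
  refine continuous_iff_seqContinuous.2 fun u z hu => ?_
  have h1 := (hd.compatible z.1 _).1 ((continuous_fst.tendsto z).comp hu)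
  have h2 := (hd.compatible z.2 _).1 ((continuous_snd.tendsto z).comp hu)
  rw [tendsto_iff_dist_tendsto_zero]
  refine squeeze_zero (fun _ => dist_nonneg) (fun n => ?_) (by simpa using h1.add h2)
  simp only [Function.comp_apply, Real.dist_eq]
  rw [abs_le]
  have t1 := hd.triangle (u n).1 z.1 (u n).2
  have t2 := hd.triangle z.1 z.2 (u n).2
  have t3 := hd.triangle z.1 (u n).1 z.2
  have t4 := hd.triangle (u n).1 (u n).2 z.2
  have s1 := hd.symm z.1 (u n).1
  have s2 := hd.symm z.2 (u n).2
  constructor <;> linarith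

end IsCompatibleMetric

section Cost

variable {p : ℝ} {dund : ℝ → ℝ → ℝ}

lemma measurable_cost2 (hd : IsCompatibleMetric dund) :
    Measurable (cost2 p dund) := by
  have h1 : Measurable fun z : (ℝ × ℝ) × (ℝ × ℝ) => dund z.1.1 z.2.1 :=
    hd.continuous.measurable.comp (by fun_prop : Measurable fun z : (ℝ × ℝ) × (ℝ × ℝ) =>
      (z.1.1, z.2.1))
  have h2 : Measurable fun z : (ℝ × ℝ) × (ℝ × ℝ) => dund z.1.2 z.2.2 :=
    hd.continuous.measurable.comp (by fun_prop : Measurable fun z : (ℝ × ℝ) × (ℝ × ℝ) =>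
      (z.1.2, z.2.2))
  exact ((h1.pow_const p).add (h2.pow_const p)).ennreal_ofReal

lemma cost2_symm (hd : IsCompatibleMetric dund) (x y : ℝ × ℝ) :
    cost2 p dund (x, y) = cost2 p dund (y, x) := by
  simp only [cost2, hd.symm x.1, hd.symm x.2]

lemma cost2_eq_zero_iff (hp : 1 ≤ p) (hd : IsCompatibleMetric dund) (x y : ℝ × ℝ) :
    cost2 p dund (x, y) = 0 ↔ x = y := by
  have hp0 : p ≠ 0 := by positivity
  have a := Real.rpow_nonneg (hd.nonneg x.1 y.1) p
  have b := Real.rpow_nonneg (hd.nonneg x.2 y.2) p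
  rw [cost2, ENNReal.ofReal_eq_zero]
  constructor
  · intro h
    have ha : dund x.1 y.1 ^ p = 0 := by linarith
    have hb : dund x.2 y.2 ^ p = 0 := by linarith
    rw [Real.rpow_eq_zero (hd.nonneg _ _) hp0] at ha hb
    exact Prod.ext (hd.eq_of_dist_eq_zero _ _ ha) (hd.eq_of_dist_eq_zero _ _ hb)
  · rintro rfl
    simp [hd.self_eq_zero, Real.zero_rpow hp0]

/-- Triangle inequality for `d`. -/
lemma cost2_rpow_triangle (hp : 1 ≤ p) (hd : IsCompatibleMetric dund) (x y z : ℝ × ℝ) :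
    cost2 p dund (x, z) ^ (1 / p) ≤
      cost2 p dund (x, y) ^ (1 / p) + cost2 p dund (y, z) ^ (1 / p) := by
  have hp0 : 0 ≤ p := by positivity
  have hc : ∀ x y : ℝ × ℝ, cost2 p dund (x, y) = ∑ i : Fin 2,
      (![ENNReal.ofReal (dund x.1 y.1), ENNReal.ofReal (dund x.2 y.2)] i) ^ p := fun x y => by
    rw [cost2, ENNReal.ofReal_add (Real.rpow_nonneg (hd.nonneg _ _) _)
      (Real.rpow_nonneg (hd.nonneg _ _) _)]
    simp [ENNReal.ofReal_rpow_of_nonneg (hd.nonneg _ _) hp0]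
  rw [hc x y, hc y z]
  refine le_trans ?_ (ENNReal.Lp_add_le _ _ _ hp)
  rw [hc x z]
  have key : ∀ a b c, ENNReal.ofReal (dund a c) ≤
      ENNReal.ofReal (dund a b) + ENNReal.ofReal (dund b c) := fun a b c => by
    rw [← ENNReal.ofReal_add (hd.nonneg _ _) (hd.nonneg _ _)]
    exact ENNReal.ofReal_le_ofReal (hd.triangle _ _ _)
  gcongr with i
  fin_cases i
  · exact key _ _ _
  · exact key _ _ _

/-- Triangle inequality for the `L^p` distance of random variables. -/
lemma lintegral_cost2_triangle {Ω : Type*} [MeasurableSpace Ω] {P : Measure Ω}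
    (hp : 1 ≤ p) (hd : IsCompatibleMetric dund) {X Y Z : Ω → ℝ × ℝ}
    (hX : AEMeasurable X P) (hY : AEMeasurable Y P) (hZ : AEMeasurable Z P) :
    (∫⁻ ω, cost2 p dund (X ω, Z ω) ∂P) ^ (1 / p) ≤
      (∫⁻ ω, cost2 p dund (X ω, Y ω) ∂P) ^ (1 / p) +
        (∫⁻ ω, cost2 p dund (Y ω, Z ω) ∂P) ^ (1 / p) := by
  have hp0 : p ≠ 0 := by positivity
  have hc := measurable_cost2 (p := p) hd
  have h1 := (hc.comp_aemeasurable (hX.prodMk hY)).pow_const (1 / p)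
  have h2 := (hc.comp_aemeasurable (hY.prodMk hZ)).pow_const (1 / p)
  have hpow : ∀ a : ℝ≥0∞, (a ^ (1 / p)) ^ p = a := fun a => by
    rw [← ENNReal.rpow_mul, one_div_mul_cancel hp0, ENNReal.rpow_one]
  have h := ENNReal.lintegral_Lp_add_le h1 h2 hp
  simp only [Pi.add_apply, Function.comp_apply, hpow] at h
  refine le_trans ?_ h
  gcongr with ω
  conv_lhs => rw [← hpow (cost2 p dund (X ω, Z ω))]
  gcongr
  exact cost2_rpow_triangle hp hd _ _ _

lemma dKR_eq (hd : IsCompatibleMetric dund) (μ ν : Measure (ℝ × ℝ))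
    [IsProbabilityMeasure μ] [IsProbabilityMeasure ν] :
    dKR p dund μ ν = (∫⁻ u, cost2 p dund (krMap μ u, krMap ν u) ∂(unif.prod unif)) ^ (1 / p) := by
  have h : KR μ ν = (unif.prod unif).map fun u => (krMap μ u, krMap ν u) := rfl
  rw [dKR, h, lintegral_map' (measurable_cost2 (p := p) hd).aemeasurable
    ((aemeasurable_krMap μ).prodMk (aemeasurable_krMap ν))]

lemma lintegral_cost2_krMap (hd : IsCompatibleMetric dund) (μ : Measure (ℝ × ℝ))
    [IsProbabilityMeasure μ] (x₀ : ℝ × ℝ) :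
    ∫⁻ u, cost2 p dund (krMap μ u, x₀) ∂(unif.prod unif) = ∫⁻ x, cost2 p dund (x, x₀) ∂μ := by
  conv_rhs => rw [← map_krMap μ]
  rw [lintegral_map' (f := fun x => cost2 p dund (x, x₀))
    ((measurable_cost2 hd).comp measurable_prodMk_right).aemeasurable (aemeasurable_krMap μ)]

lemma dKR_ne_top (hp : 1 ≤ p) (hd : IsCompatibleMetric dund) {μ ν : Measure (ℝ × ℝ)}
    (hμ : MemP2 p dund μ) (hν : MemP2 p dund ν) : dKR p dund μ ν ≠ ⊤ := by
  obtain ⟨_, x₀, hx⟩ := hμ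
  obtain ⟨_, y₀, hy⟩ := hν
  have hp0 : 0 ≤ 1 / p := by positivity
  have mμ := aemeasurable_krMap μ
  have mν := aemeasurable_krMap ν
  rw [dKR_eq hd]
  refine ne_top_of_le_ne_top ?_ ((lintegral_cost2_triangle hp hd mμ
    (aemeasurable_const (b := x₀)) mν).trans (add_le_add_right
      (lintegral_cost2_triangle hp hd aemeasurable_const (aemeasurable_const (b := y₀)) mν) _))
  simp_rw [cost2_symm hd y₀ (krMap ν _)]
  rw [lintegral_cost2_krMap hd, lintegral_cost2_krMap hd, lintegral_const, measure_univ,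
    mul_one]
  exact ENNReal.add_ne_top.2 ⟨ENNReal.rpow_ne_top_of_nonneg hp0 hx.ne,
    ENNReal.add_ne_top.2 ⟨ENNReal.rpow_ne_top_of_nonneg hp0 ENNReal.ofReal_ne_top,
      ENNReal.rpow_ne_top_of_nonneg hp0 hy.ne⟩⟩

lemma dKR_eq_zero_iff (hp : 1 ≤ p) (hd : IsCompatibleMetric dund) (μ ν : Measure (ℝ × ℝ))
    [IsProbabilityMeasure μ] [IsProbabilityMeasure ν] : dKR p dund μ ν = 0 ↔ μ = ν := by
  have mμ := aemeasurable_krMap μ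
  have mν := aemeasurable_krMap ν
  rw [dKR_eq hd, ENNReal.rpow_eq_zero_iff_of_pos (by positivity),
    lintegral_eq_zero_iff' (f := fun u => cost2 p dund (krMap μ u, krMap ν u))
      ((measurable_cost2 (p := p) hd).comp_aemeasurable (mμ.prodMk mν))]
  constructor
  · intro h
    rw [← map_krMap μ, ← map_krMap ν]
    refine Measure.map_congr ?_
    filter_upwards [h] with u hu
    exact (cost2_eq_zero_iff hp hd _ _).1 hu
  · rintro rfl
    exact .of_forall fun u => (cost2_eq_zero_iff hp hd _ _).2 rfl

end Cost

/-- the Knothe–Rosenblatt distance is a metric on `𝒫^p(ℝ²)`: finite,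
nonnegative, symmetric, vanishing exactly on the diagonal, and satisfying the triangle
inequality. -/
theorem dKR_isMetric (p : ℝ) (hp : 1 ≤ p)
    (dund : ℝ → ℝ → ℝ) (hd : IsCompatibleMetric dund)
    (μ ν η : Measure (ℝ × ℝ))
    (hμ : MemP2 p dund μ) (hν : MemP2 p dund ν) (hη : MemP2 p dund η) :
    dKR p dund μ ν ≠ ⊤ ∧
    0 ≤ dKR p dund μ ν ∧
    dKR p dund μ ν = dKR p dund ν μ ∧
    (dKR p dund μ ν = 0 ↔ μ = ν) ∧
    dKR p dund μ ν ≤ dKR p dund μ η + dKR p dund η ν := by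
  obtain ⟨_, _⟩ := id hμ
  obtain ⟨_, _⟩ := id hν
  obtain ⟨_, _⟩ := id hη
  refine ⟨dKR_ne_top hp hd hμ hν, zero_le, ?_, dKR_eq_zero_iff hp hd μ ν, ?_⟩
  · simp_rw [dKR_eq hd, cost2_symm hd (krMap μ _)]
  · simp_rw [dKR_eq hd]
    exact lintegral_cost2_triangle hp hd (aemeasurable_krMap μ) (aemeasurable_krMap η)
      (aemeasurable_krMap ν)
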